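/- For every integer n ≥ 1, every t ≥ 0 with (1-q^n)·t < 1, every x ≥ 0 and all parameters α, β ≥ 0, the operator applied to the identity function e₁(s) = s satisfies T_{n,t}^{α,β}(e₁;q;x) = x + [n]_q·t/([n]_q+β) + α/([n]_q+β) + R_{n,t}·D_qA(1)/([n]_q+β), where R_{n,t} = e_q^{q·[n]_q t}·E_q^{-[n]_q t}/A(1). -/

import Mathlib

open Filter

/-- The `q`-integer `[n]_q = (1 - q^n)/(1 - q)`. -/
noncomputable def qInt (q : ℝ) (n : ℕ) : ℝ := (1 - q ^ n) / (1 - q)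

/-- The `q`-factorial `[n]_q! = [1]_q [2]_q ⋯ [n]_q`, with `[0]_q! = 1`. -/
noncomputable def qFact (q : ℝ) (n : ℕ) : ℝ := ∏ i ∈ Finset.range n, qInt q (i + 1)

/-- The `q`-exponential `e_q^x = ∑ x^n/[n]_q!`. -/
noncomputable def qExp (q x : ℝ) : ℝ := ∑' n : ℕ, x ^ n / qFact q n

/-- The `q`-exponential `E_q^x = ∑ q^{n(n-1)/2} x^n/[n]_q!`. -/
noncomputable def qExpE (q x : ℝ) : ℝ := ∑' n : ℕ, q ^ (n * (n - 1) / 2) * x ^ n / qFact q n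

/-- The power series `A(u) = ∑ c_k u^k`. -/
noncomputable def APow (c : ℕ → ℝ) (u : ℝ) : ℝ := ∑' k : ℕ, c k * u ^ k

/-- The `q`-Appell polynomial `P_k(q;y) = [k]_q! ∑_{j=0}^k c_j y^{k-j}/[k-j]_q!`. -/
noncomputable def qAppell (c : ℕ → ℝ) (q y : ℝ) (k : ℕ) : ℝ :=
  qFact q k * ∑ j ∈ Finset.range (k + 1), c j * y ^ (k - j) / qFact q (k - j)

/-- `D_q A(1) = (A(1) - A(q))/(1-q)`. -/
noncomputable def DqA1 (c : ℕ → ℝ) (q : ℝ) : ℝ := (APow c 1 - APow c q) / (1 - q)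

/-- `D_q A(q) = (A(q) - A(q²))/((1-q) q)`. -/
noncomputable def DqAq (c : ℕ → ℝ) (q : ℝ) : ℝ := (APow c q - APow c (q ^ 2)) / ((1 - q) * q)

/-- `D_q² A(1) = (D_q A(1) - D_q A(q))/(1-q)`. -/
noncomputable def Dq2A1 (c : ℕ → ℝ) (q : ℝ) : ℝ := (DqA1 c q - DqAq c q) / (1 - q)

/-- The Stancu-type `q`-Favard–Szász operator `T_{n,t}^{α,β}(f;q;x)`. -/
noncomputable def Tq (c : ℕ → ℝ) (q : ℝ) (n : ℕ) (t α β : ℝ) (f : ℝ → ℝ) (x : ℝ) : ℝ :=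
  qExpE q (-(qInt q n * t)) / APow c 1 *
    ∑' k : ℕ, qAppell c q (qInt q n * t) k / qFact q k *
      f (x + (qInt q k + α) / (qInt q n + β))

/-- Statistical convergence of a real sequence to `l`. -/
def StatLim (x : ℕ → ℝ) (l : ℝ) : Prop :=
  ∀ ε > 0, Tendsto
    (fun n : ℕ => (((Finset.Icc 1 n).filter fun k => ε ≤ |x k - l|).card : ℝ) / n)
    atTop (nhds 0)

/-- Modulus of continuity of `f` on `[0,∞)`. -/
noncomputable def modCont (f : ℝ → ℝ) (δ : ℝ) : ℝ :=
  sSup {r : ℝ | ∃ u v : ℝ, 0 ≤ u ∧ 0 ≤ v ∧ |u - v| ≤ δ ∧ r = |f u - f v|}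

/-- Second-order modulus of smoothness of `f` on `[0,∞)`. -/
noncomputable def mod2 (f : ℝ → ℝ) (δ : ℝ) : ℝ :=
  sSup {r : ℝ | ∃ h x : ℝ, 0 < h ∧ h ≤ δ ∧ 0 ≤ x ∧
    r = |f (x + 2 * h) - 2 * f (x + h) + f x|}

lemma qInt_ge (q : ℝ) (hq0 : 0 < q) (hq1 : q < 1) (n : ℕ) : 1 ≤ qInt q (n + 1) := by
  unfold qInt
  rw [le_div_iff₀ (by linarith)]
  have : q ^ n ≤ 1 := pow_le_one₀ hq0.le hq1.le
  rw [pow_succ]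
  nlinarith

lemma qFact_succ (q : ℝ) (n : ℕ) : qFact q (n + 1) = qFact q n * qInt q (n + 1) := by
  unfold qFact
  rw [Finset.prod_range_succ]

lemma qFact_pos (q : ℝ) (hq0 : 0 < q) (hq1 : q < 1) (n : ℕ) : 0 < qFact q n := by
  unfold qFact
  exact Finset.prod_pos fun i _ => lt_of_lt_of_le one_pos (qInt_ge q hq0 hq1 i)

lemma sum_e (q : ℝ) (hq0 : 0 < q) (hq1 : q < 1) (y : ℝ) (hy : (1 - q) * |y| < 1) :
    Summable fun n : ℕ => ‖y ^ n / qFact q n‖ := by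
  obtain ⟨r, hr1, hr2⟩ := exists_between hy
  have hr0 : 0 < r := lt_of_le_of_lt (mul_nonneg (by linarith) (abs_nonneg y)) hr1
  refine Summable.norm ?_
  refine summable_of_ratio_norm_eventually_le hr2 ?_
  have hl : Tendsto (fun n : ℕ => r * (1 - q ^ (n + 1))) atTop (nhds (r * (1 - 0))) := by
    refine Tendsto.const_mul _ (Tendsto.const_sub _ ?_)
    exact (tendsto_pow_atTop_nhds_zero_of_lt_one hq0.le hq1).comp (tendsto_add_atTop_nat 1)
  have hev := hl.eventually (lt_mem_nhds (by simpa using hr1 : (1 - q) * |y| < r * (1 - 0)))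
  filter_upwards [hev] with n hn
  have h1 := qFact_pos q hq0 hq1 n
  have h2 := lt_of_lt_of_le one_pos (qInt_ge q hq0 hq1 n)
  rw [qFact_succ, pow_succ, mul_div_mul_comm, norm_mul, mul_comm]
  refine mul_le_mul_of_nonneg_right ?_ (norm_nonneg _)
  rw [norm_div, Real.norm_of_nonneg h2.le, div_le_iff₀ h2, Real.norm_eq_abs]
  unfold qInt
  rw [← mul_div_assoc, le_div_iff₀ (by linarith)]
  linarith

lemma sum_E (q : ℝ) (hq0 : 0 < q) (hq1 : q < 1) (y : ℝ) :
    Summable fun n : ℕ => ‖q ^ (n * (n - 1) / 2) * y ^ n / qFact q n‖ := by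
  refine Summable.norm ?_
  refine summable_of_ratio_norm_eventually_le (r := 1 / 2) (by norm_num) ?_
  have hl : Tendsto (fun n : ℕ => q ^ n * |y|) atTop (nhds (0 * |y|)) :=
    (tendsto_pow_atTop_nhds_zero_of_lt_one hq0.le hq1).mul_const _
  have hev := hl.eventually (gt_mem_nhds (by norm_num : 0 * |y| < 1 / 2))
  filter_upwards [hev] with n hn
  have h1 := qFact_pos q hq0 hq1 n
  have h3 := qInt_ge q hq0 hq1 n
  have h2 := lt_of_lt_of_le one_pos h3
  have e : q ^ ((n + 1) * (n + 1 - 1) / 2) * y ^ (n + 1) / qFact q (n + 1)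
      = (q ^ n * y / qInt q (n + 1)) * (q ^ (n * (n - 1) / 2) * y ^ n / qFact q n) := by
    rw [Nat.triangle_succ, qFact_succ, pow_add, pow_succ]
    field_simp
  rw [e, norm_mul]
  refine mul_le_mul_of_nonneg_right ?_ (norm_nonneg _)
  rw [norm_div, Real.norm_of_nonneg h2.le, div_le_iff₀ h2, Real.norm_eq_abs, abs_mul,
    abs_of_pos (pow_pos hq0 n)]
  nlinarith

/-- coefficients of `e` scaled. -/
noncomputable def eS (q y : ℝ) : PowerSeries ℝ := PowerSeries.mk fun n => y ^ n / qFact q n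

noncomputable def ES (q y : ℝ) : PowerSeries ℝ :=
  PowerSeries.mk fun n => q ^ (n * (n - 1) / 2) * (-y) ^ n / qFact q n

lemma qInt_mul (q : ℝ) (hq1 : q < 1) (n : ℕ) : (1 - q) * qInt q n = 1 - q ^ n := by
  unfold qInt
  have : 1 - q ≠ 0 := by linarith
  field_simp

lemma coeff_e (q : ℝ) (hq0 : 0 < q) (hq1 : q < 1) (y : ℝ) (n : ℕ) :
    y ^ (n + 1) / qFact q (n + 1) - q ^ (n + 1) * (y ^ (n + 1) / qFact q (n + 1))
      = (1 - q) * y * (y ^ n / qFact q n) := by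
  have h1 := (qFact_pos q hq0 hq1 n).ne'
  have h2 := (lt_of_lt_of_le one_pos (qInt_ge q hq0 hq1 n)).ne'
  have h3 := qInt_mul q hq1 (n + 1)
  rw [← one_sub_mul, ← h3, qFact_succ]
  field_simp
  ring

lemma eS_rescale (q : ℝ) (hq0 : 0 < q) (hq1 : q < 1) (y : ℝ) :
    PowerSeries.rescale q (eS q y)
      = (1 - PowerSeries.C ((1 - q) * y) * PowerSeries.X) * eS q y := by
  ext m
  rw [PowerSeries.coeff_rescale, sub_mul, one_mul, mul_assoc, map_sub, PowerSeries.coeff_C_mul]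
  cases m with
  | zero => simp
  | succ n =>
    rw [PowerSeries.coeff_succ_X_mul]
    simp only [eS, PowerSeries.coeff_mk]
    linarith [coeff_e q hq0 hq1 y n]

lemma ES_rescale (q : ℝ) (hq0 : 0 < q) (hq1 : q < 1) (y : ℝ) :
    ES q y = (1 - PowerSeries.C ((1 - q) * y) * PowerSeries.X) *
      PowerSeries.rescale q (ES q y) := by
  ext m
  rw [sub_mul, one_mul, mul_assoc, map_sub, PowerSeries.coeff_C_mul, PowerSeries.coeff_rescale]
  cases m with
  | zero => simp
  | succ n =>
    rw [PowerSeries.coeff_succ_X_mul, PowerSeries.coeff_rescale]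
    simp only [ES, PowerSeries.coeff_mk]
    have h1 := (qFact_pos q hq0 hq1 n).ne'
    have h2 := (lt_of_lt_of_le one_pos (qInt_ge q hq0 hq1 n)).ne'
    have h3 := qInt_mul q hq1 (n + 1)
    rw [Nat.triangle_succ, qFact_succ]
    have h4 : q ^ (n+1) = 1 - (1 - q) * qInt q (n + 1) := by linarith [qInt_mul q hq1 (n + 1)]
    rw [h4, pow_add, pow_succ (-y)]
    field_simp
    ring

lemma E_mul_e (q : ℝ) (hq0 : 0 < q) (hq1 : q < 1) (y : ℝ) (hy : (1 - q) * |y| < 1) :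
    qExpE q (-y) * qExp q y = 1 := by
  unfold qExpE qExp
  rw [tsum_mul_tsum_eq_tsum_sum_antidiagonal_of_summable_norm (sum_E q hq0 hq1 (-y))
    (sum_e q hq0 hq1 y hy)]
  have key : PowerSeries.rescale q (ES q y * eS q y) = ES q y * eS q y := by
    rw [map_mul, eS_rescale q hq0 hq1]
    conv_rhs => rw [ES_rescale q hq0 hq1]
    ring
  rw [tsum_eq_single 0]
  · simp [qFact]
  · intro m hm
    have h := congrArg (PowerSeries.coeff m) key
    rw [PowerSeries.coeff_rescale] at h
    have hlt : q ^ m < 1 := pow_lt_one₀ hq0.le hq1 hm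
    have h0 : PowerSeries.coeff m (ES q y * eS q y) = 0 := by
      have : (1 - q ^ m) * PowerSeries.coeff m (ES q y * eS q y) = 0 := by linarith
      rcases mul_eq_zero.mp this with h | h
      · linarith
      · exact h
    rw [PowerSeries.coeff_mul] at h0
    simpa only [ES, eS, PowerSeries.coeff_mk] using h0

lemma e_q (q : ℝ) (hq0 : 0 < q) (hq1 : q < 1) (y : ℝ) (hy : (1 - q) * |y| < 1) :
    qExp q y - qExp q (q * y) = (1 - q) * y * qExp q y := by
  have hs := (sum_e q hq0 hq1 y hy).of_norm
  have hy' : (1 - q) * |q * y| < 1 := by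
    rw [abs_mul, abs_of_pos hq0]
    have : 0 ≤ (1 - q) * |y| := mul_nonneg (by linarith) (abs_nonneg y)
    nlinarith
  have hs' := (sum_e q hq0 hq1 (q * y) hy').of_norm
  unfold qExp
  rw [← hs.tsum_sub hs', (hs.sub hs').tsum_eq_zero_add, ← tsum_mul_left]
  simp only [pow_zero, sub_self, zero_add]
  refine tsum_congr fun n => ?_
  rw [← coeff_e q hq0 hq1 y n, mul_pow, mul_div_assoc]

lemma pow_add_sub_aux (u : ℝ) {j k : ℕ} (h : j ≤ k) : u ^ j * u ^ (k - j) = u ^ k := by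
  rw [← pow_add, Nat.add_sub_cancel' h]

lemma gen (q : ℝ) (hq0 : 0 < q) (hq1 : q < 1) (y u : ℝ) (hy : (1 - q) * |u * y| < 1)
    (c : ℕ → ℝ) (hcs : Summable fun k => ‖c k * u ^ k‖) :
    HasSum (fun k => qAppell c q y k / qFact q k * u ^ k) (APow c u * qExp q (u * y)) := by
  have hs := sum_e q hq0 hq1 (u * y) hy
  have e : (fun k => qAppell c q y k / qFact q k * u ^ k) = fun k =>
      ∑ j ∈ Finset.range (k + 1),
        (c j * u ^ j) * ((u * y) ^ (k - j) / qFact q (k - j)) := by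
    ext k
    unfold qAppell
    rw [mul_div_cancel_left₀ _ (qFact_pos q hq0 hq1 k).ne', Finset.sum_mul]
    refine Finset.sum_congr rfl fun j hj => ?_
    have hj' : j ≤ k := Nat.lt_succ_iff.mp (Finset.mem_range.mp hj)
    rw [mul_pow, ← pow_add_sub_aux u hj']
    ring
  rw [e]
  unfold APow qExp
  rw [tsum_mul_tsum_eq_tsum_sum_range_of_summable_norm hcs hs]
  exact (summable_norm_sum_mul_range_of_summable_norm hcs hs).of_norm.hasSum

/-- `T_{n,t}^{α,β}(e₁;q;x) = x + [n]_q t/([n]_q+β) + α/([n]_q+β)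
    + R_{n,t} D_qA(1)/([n]_q+β)` with `R_{n,t} = e_q^{q[n]_q t} E_q^{-[n]_q t}/A(1)`. -/
theorem stmt_4 (q : ℝ) (hq0 : 0 < q) (hq1 : q < 1)
    (c : ℕ → ℝ) (hc : ∀ k, 0 ≤ c k)
    (hrad : ∃ R : ℝ, 1 < R ∧ Summable fun k => c k * R ^ k) (hA1 : 0 < APow c 1)
    (n : ℕ) (hn : 1 ≤ n) (t : ℝ) (ht0 : 0 ≤ t) (ht1 : (1 - q ^ n) * t < 1)
    (x : ℝ) (hx : 0 ≤ x) (α β : ℝ) (hα : 0 ≤ α) (hβ : 0 ≤ β) :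
    Tq c q n t α β (fun s => s) x =
      x + qInt q n * t / (qInt q n + β) + α / (qInt q n + β)
        + (qExp q (q * (qInt q n * t)) * qExpE q (-(qInt q n * t)) / APow c 1)
            * DqA1 c q / (qInt q n + β) := by
  obtain ⟨R, hR, hRs⟩ := hrad
  have hsu : ∀ u : ℝ, 0 ≤ u → u ≤ 1 → Summable fun k => ‖c k * u ^ k‖ := by
    intro u hu0 hu1
    refine Summable.of_nonneg_of_le (fun _ => norm_nonneg _) (fun k => ?_) hRs
    rw [Real.norm_of_nonneg (mul_nonneg (hc k) (pow_nonneg hu0 k))]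
    exact mul_le_mul_of_nonneg_left (pow_le_pow_left₀ hu0 (by linarith) k) (hc k)
  have hN : 0 < qInt q n := by
    obtain ⟨m, rfl⟩ : ∃ m, n = m + 1 := ⟨n - 1, by omega⟩
    exact lt_of_lt_of_le one_pos (qInt_ge q hq0 hq1 m)
  have hNm := qInt_mul q hq1 n
  unfold Tq DqA1
  generalize hN' : qInt q n = N at *
  have hy0 : 0 ≤ N * t := by positivity
  have hy : (1 - q) * |N * t| < 1 := by
    rw [abs_of_nonneg hy0, ← mul_assoc, hNm]; exact ht1
  generalize N * t = y at *
  have hy' : (1 - q) * |q * y| < 1 := by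
    rw [abs_mul, abs_of_pos hq0]
    have : 0 ≤ (1 - q) * |y| := mul_nonneg (by linarith) (abs_nonneg y)
    nlinarith
  have g1 := gen q hq0 hq1 y 1 (by simpa using hy) c (hsu 1 zero_le_one le_rfl)
  have g2 := gen q hq0 hq1 y q hy' c (hsu q hq0.le hq1.le)
  have hE := E_mul_e q hq0 hq1 y hy
  have he := e_q q hq0 hq1 y hy
  have hb : N + β ≠ 0 := by positivity
  have hq : 1 - q ≠ 0 := by linarith
  simp only [one_pow, mul_one, one_mul] at g1
  have hsum := (g1.mul_right (x + (1 / (1 - q) + α) / (N + β))).sub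
    (g2.mul_right (1 / (1 - q) / (N + β)))
  have hts : (∑' k : ℕ, qAppell c q y k / qFact q k * (x + (qInt q k + α) / (N + β)))
      = APow c 1 * qExp q y * (x + (1 / (1 - q) + α) / (N + β)) -
        APow c q * qExp q (q * y) * (1 / (1 - q) / (N + β)) := by
    rw [← hsum.tsum_eq]
    refine tsum_congr fun k => ?_
    unfold qInt
    ring
  beta_reduce
  rw [hts]
  generalize APow c 1 = A at *
  generalize APow c q = B at *
  generalize qExpE q (-y) = E at *
  have he' : qExp q (q * y) = qExp q y - (1 - q) * y * qExp q y := by linarith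
  rw [he']
  generalize qExp q y = e at *
  have hA : A ≠ 0 := hA1.ne'
  have hE0 : E = 1 / e := by
    have : e ≠ 0 := by rintro rfl; simp at hE
    field_simp; exact hE
  have hee : e ≠ 0 := by rintro rfl; simp at hE
  subst hE0
  field_simp
  ring
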